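/- (Quasiconcavification, after Crouzeix.) Let u : B(w) → ℝ be continuous and non-decreasing, and define ū(x) = inf{v̄(p, ⟨p,x⟩) : p ∈ ℝ^K strictly positive} for x ∈ B(w). Then: ū is non-decreasing and quasiconcave on B(w); ū(x) ≥ u(x) for all x ∈ B(w); ū is the smallest such function, i.e. every continuous, non-decreasing, quasiconcave g : B(w) → ℝ with g ≥ u on B(w) satisfies g ≥ ū on B(w); and ū = u on B(w) if and only if u is quasiconcave. -/

import Mathlib

/-- Euclidean inner product on `ℝ^K`. -/
noncomputable def dot {K : ℕ} (p x : Fin K → ℝ) : ℝ := ∑ k, p k * x k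

/-- Strictly positive vector. -/
def posVec {K : ℕ} (p : Fin K → ℝ) : Prop := ∀ k, 0 < p k

/-- The box `B(w) = {x : 0 ≤ x ≤ w}` of bundles dominated by the total endowment. -/
def Box {K : ℕ} (w : Fin K → ℝ) : Set (Fin K → ℝ) := {x | ∀ k, 0 ≤ x k ∧ x k ≤ w k}

/-- `vbar` is the restricted-domain indirect utility of `u : B(w) → ℝ`:
`vbar p m = max {u x : x ∈ B(w), ⟨p,x⟩ ≤ m}` for strictly positive `p` and `m ≥ 0`. -/
def IsRestrictedIndirectUtility {K : ℕ} (w : Fin K → ℝ) (u : (Fin K → ℝ) → ℝ)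
    (vbar : (Fin K → ℝ) → ℝ → ℝ) : Prop :=
  ∀ p m, posVec p → 0 ≤ m →
    IsGreatest {t | ∃ x ∈ Box w, dot p x ≤ m ∧ u x = t} (vbar p m)

/-- The quasiconcavification `ū(x) = inf {vbar (p, ⟨p,x⟩) : p strictly positive}`. -/
noncomputable def quasiConcavification {K : ℕ} (vbar : (Fin K → ℝ) → ℝ → ℝ)
    (x : Fin K → ℝ) : ℝ :=
  sInf {t | ∃ p, posVec p ∧ vbar p (dot p x) = t}

open scoped Pointwise in
/-- A point with no element of the compact convex set `C` of non-negative vectors below it is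
strictly separated from `C` by a strictly positive price vector. -/
theorem exists_posVec_dot_lt {K : ℕ} {C : Set (Fin K → ℝ)} (hC : IsCompact C)
    (hconv : Convex ℝ C) (hnn : ∀ y ∈ C, 0 ≤ y) {x : Fin K → ℝ} (hx : ∀ y ∈ C, ¬ y ≤ x) :
    ∃ p, posVec p ∧ ∀ y ∈ C, dot p x < dot p y := by
  rcases C.eq_empty_or_nonempty with rfl | ⟨c, hc⟩
  · exact ⟨fun _ => 1, fun _ => one_pos, by simp⟩
  have hclosed : IsClosed (C + Set.Ici (0 : Fin K → ℝ)) := isClosed_Ici.add_left_of_isCompact hC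
  have hD : Convex ℝ (C + Set.Ici (0 : Fin K → ℝ)) := hconv.add (convex_Ici 0)
  have hxD : x ∉ C + Set.Ici (0 : Fin K → ℝ) := by
    rintro ⟨y, hy, v, hv, rfl⟩
    exact hx y hy (le_add_of_nonneg_right hv)
  obtain ⟨f, s, hfx, hfs⟩ := geometric_hahn_banach_point_closed hD hclosed hxD
  set q : Fin K → ℝ := fun k => f (Pi.single k 1) with hq
  have hf : ∀ y, f y = dot q y := fun y => by
    conv_lhs => rw [← Finset.univ_sum_single y]
    rw [map_sum]
    refine Finset.sum_congr rfl fun k _ => ?_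
    rw [hq, mul_comm, ← smul_eq_mul, ← map_smul, ← Pi.single_smul, smul_eq_mul, mul_one]
  have hCs : ∀ y ∈ C, s < f y := fun y hy =>
    hfs y ⟨y, hy, 0, Set.self_mem_Ici, add_zero y⟩
  have hq0 : ∀ k, 0 ≤ q k := by
    intro k
    by_contra! hk
    have ht : 0 ≤ (s - f c) / q k :=
      div_nonneg_of_nonpos (sub_nonpos.2 (hCs c hc).le) hk.le
    have h := hfs _ ⟨c, hc, ((s - f c) / q k) • Pi.single k (1 : ℝ),
      Set.mem_Ici.2 (smul_nonneg ht (Pi.single_nonneg.2 zero_le_one)), rfl⟩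
    have h' : (s - f c) / q k * f (Pi.single k 1) = s - f c := div_mul_cancel₀ _ hk.ne
    simp only [map_add, map_smul, smul_eq_mul, h'] at h
    linarith
  obtain ⟨δ, hδ, hδs⟩ : ∃ δ : ℝ, 0 < δ ∧ f x + δ * ∑ k, x k < s := by
    refine ⟨(s - f x) / (2 * (|∑ k, x k| + 1)), by have := sub_pos.2 hfx; positivity, ?_⟩
    have h1 : (s - f x) / (2 * (|∑ k, x k| + 1)) * (|∑ k, x k| + 1) = (s - f x) / 2 := by
      field_simp
    have h2 : (0 : ℝ) ≤ (s - f x) / (2 * (|∑ k, x k| + 1)) := by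
      have := sub_pos.2 hfx; positivity
    have h3 := mul_le_mul_of_nonneg_left
      ((le_abs_self (∑ k, x k)).trans (le_add_of_nonneg_right zero_le_one)) h2
    linarith
  have hdot : ∀ y, dot (fun k => q k + δ) y = f y + δ * ∑ k, y k := fun y => by
    simp only [hf, dot, add_mul, Finset.sum_add_distrib, Finset.mul_sum]
  refine ⟨fun k => q k + δ, fun k => add_pos_of_nonneg_of_pos (hq0 k) hδ, fun y hy => ?_⟩
  rw [hdot, hdot]
  have h1 : 0 ≤ δ * ∑ k, y k := mul_nonneg hδ.le (Finset.sum_nonneg fun k _ => hnn y hy k)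
  linarith [hCs y hy]

theorem Box_eq_Icc {K : ℕ} (w : Fin K → ℝ) : Box w = Set.Icc 0 w := by
  ext x
  simp [Box, Pi.le_def, forall_and]

theorem dot_nonneg {K : ℕ} {w p x : Fin K → ℝ} (hp : posVec p) (hx : x ∈ Box w) :
    0 ≤ dot p x :=
  Finset.sum_nonneg fun k _ => mul_nonneg (hp k).le (hx k).1

theorem dot_le_dot {K : ℕ} {p x y : Fin K → ℝ} (hp : posVec p) (h : ∀ k, x k ≤ y k) :
    dot p x ≤ dot p y :=
  Finset.sum_le_sum fun k _ => mul_le_mul_of_nonneg_left (h k) (hp k).le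

theorem dot_combo {K : ℕ} (p x y : Fin K → ℝ) (a b : ℝ) :
    dot p (a • x + b • y) = a * dot p x + b * dot p y := by
  simp only [dot, Finset.mul_sum, ← Finset.sum_add_distrib, Pi.add_apply, Pi.smul_apply,
    smul_eq_mul]
  exact Finset.sum_congr rfl fun k _ => by ring

namespace IsRestrictedIndirectUtility

variable {K : ℕ} {w : Fin K → ℝ} {u : (Fin K → ℝ) → ℝ} {vbar : (Fin K → ℝ) → ℝ → ℝ}

theorem mono (h : IsRestrictedIndirectUtility w u vbar) {p : Fin K → ℝ} (hp : posVec p)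
    {m n : ℝ} (hm : 0 ≤ m) (hmn : m ≤ n) : vbar p m ≤ vbar p n := by
  obtain ⟨y, hy, hym, hyv⟩ := (h p m hp hm).1
  exact (h p n hp (hm.trans hmn)).2 ⟨y, hy, hym.trans hmn, hyv⟩

theorem le_vbar (h : IsRestrictedIndirectUtility w u vbar) {p x : Fin K → ℝ} (hp : posVec p)
    (hx : x ∈ Box w) : u x ≤ vbar p (dot p x) :=
  (h p _ hp (dot_nonneg hp hx)).2 ⟨x, hx, le_rfl, rfl⟩

theorem le_quasiConcavification_iff (h : IsRestrictedIndirectUtility w u vbar)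
    {x : Fin K → ℝ} (hx : x ∈ Box w) {c : ℝ} :
    c ≤ quasiConcavification vbar x ↔ ∀ p, posVec p → c ≤ vbar p (dot p x) := by
  have hbdd : BddBelow {t | ∃ p, posVec p ∧ vbar p (dot p x) = t} := by
    refine ⟨u x, ?_⟩
    rintro _ ⟨p, hp, rfl⟩
    exact h.le_vbar hp hx
  refine (le_csInf_iff hbdd ⟨_, fun _ => 1, fun _ => one_pos, rfl⟩).trans ?_
  exact ⟨fun H p hp => H _ ⟨p, hp, rfl⟩, by rintro H _ ⟨p, hp, rfl⟩; exact H p hp⟩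

theorem le_quasiConcavification (h : IsRestrictedIndirectUtility w u vbar)
    {x : Fin K → ℝ} (hx : x ∈ Box w) : u x ≤ quasiConcavification vbar x :=
  (h.le_quasiConcavification_iff hx).2 fun _ hp => h.le_vbar hp hx

theorem convex_le_quasiConcavification (h : IsRestrictedIndirectUtility w u vbar) (c : ℝ) :
    Convex ℝ {x | x ∈ Box w ∧ c ≤ quasiConcavification vbar x} := by
  rintro x ⟨hx, hcx⟩ y ⟨hy, hcy⟩ a b ha hb hab
  have hz : a • x + b • y ∈ Box w := by
    rw [Box_eq_Icc] at *
    exact convex_Icc 0 w hx hy ha hb hab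
  refine ⟨hz, (h.le_quasiConcavification_iff hz).2 fun p hp => ?_⟩
  rw [dot_combo]
  have hmin : min (dot p x) (dot p y) ≤ a * dot p x + b * dot p y :=
    Convex.min_le_combo _ _ ha hb hab
  rcases min_choice (dot p x) (dot p y) with he | he <;> rw [he] at hmin
  · exact ((h.le_quasiConcavification_iff hx).1 hcx p hp).trans
      (h.mono hp (dot_nonneg hp hx) hmin)
  · exact ((h.le_quasiConcavification_iff hy).1 hcy p hp).trans
      (h.mono hp (dot_nonneg hp hy) hmin)

theorem quasiConcavification_le (h : IsRestrictedIndirectUtility w u vbar)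
    {g : (Fin K → ℝ) → ℝ} (hg : ContinuousOn g (Box w))
    (hmono : ∀ x ∈ Box w, ∀ y ∈ Box w, (∀ k, x k ≤ y k) → g x ≤ g y)
    (hqc : ∀ c : ℝ, Convex ℝ {x | x ∈ Box w ∧ c ≤ g x})
    (hug : ∀ x ∈ Box w, u x ≤ g x) {x : Fin K → ℝ} (hx : x ∈ Box w) :
    quasiConcavification vbar x ≤ g x := by
  refine le_of_forall_pos_le_add fun ε hε => ?_
  have hBox : IsCompact (Box w) := by
    rw [Box_eq_Icc]
    exact isCompact_Icc
  have hC : IsCompact {y | y ∈ Box w ∧ g x + ε ≤ g y} :=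
    hBox.of_isClosed_subset
      (hg.preimage_isClosed_of_isClosed hBox.isClosed isClosed_Ici) fun _ hy => hy.1
  obtain ⟨p, hp, hsep⟩ := exists_posVec_dot_lt hC (hqc _) (fun y hy k => (hy.1 k).1)
    (x := x) fun y hy hyx => by linarith [hmono y hy.1 x hx hyx, hy.2]
  refine ((h.le_quasiConcavification_iff hx).1 le_rfl p hp).trans ?_
  obtain ⟨y, hy, hyx, hyv⟩ := (h p _ hp (dot_nonneg hp hx)).1
  rw [← hyv]
  by_contra! hlt
  exact (hsep y ⟨hy, hlt.le.trans (hug y hy)⟩).not_ge hyx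

end IsRestrictedIndirectUtility

/-- quasiconcavification, after Crouzeix: `ū` is non-decreasing and
quasiconcave on `B(w)`, dominates `u`, is the smallest such function, and coincides with
`u` iff `u` is quasiconcave. -/
theorem quasiConcavification_spec {K : ℕ} (hK : 1 ≤ K)
    (w : Fin K → ℝ) (hw : posVec w)
    (u : (Fin K → ℝ) → ℝ)
    (hu_cont : ContinuousOn u (Box w))
    (hu_mono : ∀ x ∈ Box w, ∀ y ∈ Box w, (∀ k, x k ≤ y k) → u x ≤ u y)
    (vbar : (Fin K → ℝ) → ℝ → ℝ)
    (hvbar : IsRestrictedIndirectUtility w u vbar) :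
    -- ū is non-decreasing on B(w)
    (∀ x ∈ Box w, ∀ y ∈ Box w, (∀ k, x k ≤ y k) →
      quasiConcavification vbar x ≤ quasiConcavification vbar y) ∧
    -- ū is quasiconcave on B(w)
    (∀ c : ℝ, Convex ℝ {x | x ∈ Box w ∧ c ≤ quasiConcavification vbar x}) ∧
    -- ū dominates u on B(w)
    (∀ x ∈ Box w, u x ≤ quasiConcavification vbar x) ∧
    -- ū is the smallest continuous, non-decreasing, quasiconcave function dominating u
    (∀ g : (Fin K → ℝ) → ℝ, ContinuousOn g (Box w) →
      (∀ x ∈ Box w, ∀ y ∈ Box w, (∀ k, x k ≤ y k) → g x ≤ g y) →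
      (∀ c : ℝ, Convex ℝ {x | x ∈ Box w ∧ c ≤ g x}) →
      (∀ x ∈ Box w, u x ≤ g x) →
      ∀ x ∈ Box w, quasiConcavification vbar x ≤ g x) ∧
    -- ū = u on B(w) iff u is quasiconcave on B(w)
    ((∀ x ∈ Box w, quasiConcavification vbar x = u x) ↔
      ∀ c : ℝ, Convex ℝ {x | x ∈ Box w ∧ c ≤ u x}) := by
  refine ⟨fun x hx y hy hxy => ?_, hvbar.convex_le_quasiConcavification,
    fun x hx => hvbar.le_quasiConcavification hx,
    fun g hg hmono hqc hug x hx => hvbar.quasiConcavification_le hg hmono hqc hug hx,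
    fun heq c => ?_, fun hqc x hx => le_antisymm
      (hvbar.quasiConcavification_le hu_cont hu_mono hqc (fun _ _ => le_rfl) hx)
      (hvbar.le_quasiConcavification hx)⟩
  · exact (hvbar.le_quasiConcavification_iff hy).2 fun p hp =>
      ((hvbar.le_quasiConcavification_iff hx).1 le_rfl p hp).trans
        (hvbar.mono hp (dot_nonneg hp hx) (dot_le_dot hp hxy))
  · convert hvbar.convex_le_quasiConcavification c using 1
    ext x
    exact and_congr_right fun hx => by rw [heq x hx]
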